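/- arXiv:2107.14792 — 2 statements merged into one kernel-verified Lean document; each statement's English description precedes it below -/
import Mathlib

section
/- Let n ≥ 1 and p ≥ 0 be integers and let q be any integer. With the convention that the binomial coefficient C(a, m) of an integer a over a natural number m is 0 whenever a < m, the following identity holds: n! · Σ_{k=0}^{p} [ C(n+q+k−1, n−1) + (−1)^{n−1} · C(−q−k−1, n−1) ] = ∏_{j=1}^{n} (p+q+j) − ∏_{j=0}^{n−1} (q+j). -/
open Finset

/-- The binomial coefficient `C(a, m)` with integer upper argument `a`, set to `0`
whenever `a < m`. -/
def ichoose (a : ℤ) (m : ℕ) : ℤ := if a < (m : ℤ) then 0 else (a.toNat).choose m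

theorem factorial_mul_ichoose_natCast_add (x m : ℕ) :
    (Nat.factorial m : ℤ) * ichoose ((x : ℤ) + m) m = ∏ j ∈ range m, ((x : ℤ) + 1 + j) := by
  have h := Nat.ascFactorial_eq_factorial_mul_choose x m
  rw [Nat.ascFactorial_eq_prod_range] at h
  have ht : ((x : ℤ) + m).toNat = x + m := by omega
  rw [ichoose, if_neg (by omega), ht]
  exact_mod_cast h.symm

theorem ichoose_of_lt {a : ℤ} {m : ℕ} (h : a < m) : ichoose a m = 0 := if_pos h

/-- The two truncated binomial coefficients together give the polynomial
`(x + 1) ⋯ (x + m) / m!` at every integer `x`. -/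
theorem factorial_mul_ichoose_add_ichoose (x : ℤ) (m : ℕ) :
    (Nat.factorial m : ℤ) * (ichoose (x + m) m + (-1) ^ m * ichoose (-x - 1) m) =
      ∏ j ∈ range m, (x + 1 + j) := by
  rcases le_or_gt 0 x with hx | hx
  · lift x to ℕ using hx
    rw [ichoose_of_lt (a := -(x : ℤ) - 1) (by omega), mul_zero, add_zero,
      factorial_mul_ichoose_natCast_add]
  rw [ichoose_of_lt (a := x + m) (by omega), zero_add]
  rcases le_or_gt 0 (x + m) with hxm | hxm
  · rw [ichoose_of_lt (a := -x - 1) (by omega), mul_zero, mul_zero, eq_comm]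
    exact prod_eq_zero (i := (-x - 1).toNat) (mem_range.2 (by omega)) (by omega)
  · obtain ⟨y, hy⟩ := Int.eq_ofNat_of_zero_le (show 0 ≤ -x - 1 - m by omega)
    obtain rfl : x = -(y : ℤ) - 1 - m := by omega
    rw [show -(-(y : ℤ) - 1 - m) - 1 = y + m by ring, mul_left_comm,
      factorial_mul_ichoose_natCast_add, ← prod_range_reflect,
      show (-1 : ℤ) ^ m = ∏ _j ∈ range m, (-1) by simp, ← prod_mul_distrib]
    refine prod_congr rfl fun j hj => ?_
    have := mem_range.1 hj
    rw [Nat.cast_sub (by omega), Nat.cast_sub (by omega)]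
    push_cast
    ring

theorem succ_mul_prod_range_add_one_add (x : ℤ) (m : ℕ) :
    ((m : ℤ) + 1) * ∏ j ∈ range m, (x + 1 + j) =
      ∏ j ∈ range (m + 1), (x + 1 + j) - ∏ j ∈ range (m + 1), (x + j) := by
  have h : ∏ j ∈ range m, (x + ((j + 1 : ℕ) : ℤ)) = ∏ j ∈ range m, (x + 1 + j) :=
    prod_congr rfl fun j _ => by push_cast; ring
  rw [prod_range_succ, prod_range_succ' (fun j : ℕ => x + (j : ℤ)), h]
  push_cast
  ring

/-- The Euler characteristic identity
`n! · Σ_{k=0}^{p} [C(n+q+k−1, n−1) + (−1)^{n−1}·C(−q−k−1, n−1)]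
  = ∏_{j=1}^{n} (p+q+j) − ∏_{j=0}^{n−1} (q+j)`. -/
theorem stmt_3 (n p : ℕ) (hn : 1 ≤ n) (q : ℤ) :
    (Nat.factorial n : ℤ) *
        ∑ k ∈ Finset.range (p + 1),
          (ichoose ((n : ℤ) + q + (k : ℤ) - 1) (n - 1) +
            (-1) ^ (n - 1) * ichoose (-q - (k : ℤ) - 1) (n - 1)) =
      (∏ j ∈ Finset.Icc 1 n, ((p : ℤ) + q + (j : ℤ))) -
        ∏ j ∈ Finset.range n, (q + (j : ℤ)) := by
  obtain ⟨m, rfl⟩ := Nat.exists_eq_add_of_le' hn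
  have hterm (k : ℕ) : (Nat.factorial (m + 1) : ℤ) *
      (ichoose (((m + 1 : ℕ) : ℤ) + q + k - 1) m + (-1) ^ m * ichoose (-q - k - 1) m) =
      ∏ j ∈ range (m + 1), (q + (k + 1 : ℕ) + j) - ∏ j ∈ range (m + 1), (q + k + j) := by
    have h := succ_mul_prod_range_add_one_add (q + k) m
    rw [← factorial_mul_ichoose_add_ichoose] at h
    rw [show ((m + 1 : ℕ) : ℤ) + q + k - 1 = q + k + m by push_cast; ring,
      show -q - (k : ℤ) - 1 = -(q + k) - 1 by ring, Nat.factorial_succ]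
    push_cast
    rw [mul_assoc, h]
    simp only [add_assoc]
  have hIcc : ∏ j ∈ Icc 1 (m + 1), ((p : ℤ) + q + j) =
      ∏ j ∈ range (m + 1), (q + (p + 1 : ℕ) + j) := by
    rw [← Ico_add_one_right_eq_Icc, prod_Ico_eq_prod_range]
    refine prod_congr rfl fun j _ => ?_
    push_cast
    ring
  rw [Nat.add_sub_cancel, mul_sum, sum_congr rfl fun k _ => hterm k,
    sum_range_sub (fun k : ℕ => ∏ j ∈ range (m + 1), (q + (k : ℤ) + j)), hIcc]
  simp only [Nat.cast_zero, add_zero]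
end

section
/- Let n ≥ 3 be an integer and let R_n = ℤ[α,ξ]/(αⁿ, ξ² − α·ξ). Then in R_n the identity (−2α) · (2ξ + (n−3)·α)^{n−1} = 2·((n−3)^{n−1} − (n−1)^{n−1}) · ξⁿ holds; equivalently α · (2ξ + (n−3)·α)^{n−1} = ((n−1)^{n−1} − (n−3)^{n−1}) · ξⁿ. (This is the computation giving the slope μ_L(E) = (1/2^{n−1})·[(n−3)^{n−1} − (n−1)^{n−1}] of the rank-2 instanton E on the blow-up of ℙⁿ at a point with c₁(E) = −2α and polarisation L = O(1,(n−3)/2).) -/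
open MvPolynomial

/-- The ideal `(αⁿ, ξ² − α·ξ)` in `ℤ[α,ξ]`, where `α = X 0` and `ξ = X 1`. -/
noncomputable def chowIdeal (n : ℕ) : Ideal (MvPolynomial (Fin 2) ℤ) :=
  Ideal.span {X 0 ^ n, X 1 ^ 2 - X 0 * X 1}

/-- The Chow ring `R_n = ℤ[α,ξ]/(αⁿ, ξ² − α·ξ)` of the blow-up of `ℙⁿ` at a point. -/
def ChowRing (n : ℕ) : Type := MvPolynomial (Fin 2) ℤ ⧸ chowIdeal n

noncomputable instance (n : ℕ) : CommRing (ChowRing n) := Ideal.Quotient.commRing (chowIdeal n)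

/-- The class `α` in `R_n`. -/
noncomputable def chowα (n : ℕ) : ChowRing n := Ideal.Quotient.mk (chowIdeal n) (X 0)

/-- The class `ξ` in `R_n`. -/
noncomputable def chowξ (n : ℕ) : ChowRing n := Ideal.Quotient.mk (chowIdeal n) (X 1)


theorem mul_pow_eq_pow_succ_of_sq_eq_mul {R : Type*} [CommRing R] {a x : R}
    (h : x ^ 2 = a * x) (m : ℕ) : a ^ m * x = x ^ (m + 1) := by
  induction m with
  | zero => simp
  | succ m ih => linear_combination a * ih - x ^ m * h

theorem mul_two_mul_add_mul_pow_of_sq_eq_mul {R : Type*} [CommRing R] {a x : R}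
    (h : x ^ 2 = a * x) (c : R) (m : ℕ) :
    a * (2 * x + c * a) ^ m = c ^ m * a ^ (m + 1) + ((c + 2) ^ m - c ^ m) * x ^ (m + 1) := by
  induction m with
  | zero => simp
  | succ m ih =>
    have hx := mul_pow_eq_pow_succ_of_sq_eq_mul h (m + 1)
    linear_combination (2 * x + c * a) * ih + 2 * c ^ m * hx -
      c * ((c + 2) ^ m - c ^ m) * x ^ m * h

theorem chowα_pow (n : ℕ) : chowα n ^ n = 0 :=
  Ideal.Quotient.eq_zero_iff_mem.mpr (Ideal.subset_span (Set.mem_insert _ _))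

theorem chowξ_sq (n : ℕ) : chowξ n ^ 2 = chowα n * chowξ n :=
  Ideal.Quotient.eq.mpr (Ideal.subset_span (Set.mem_insert_of_mem _ rfl))

/-- In `R_n` (for `n ≥ 3`) one has
`(−2α)·(2ξ + (n−3)α)^{n−1} = 2·((n−3)^{n−1} − (n−1)^{n−1})·ξⁿ`, equivalently
`α·(2ξ + (n−3)α)^{n−1} = ((n−1)^{n−1} − (n−3)^{n−1})·ξⁿ`: the slope computation
`μ_L(E) = (1/2^{n−1})·[(n−3)^{n−1} − (n−1)^{n−1}]` for the instanton with
`c₁(E) = −2α` and `L = O(1,(n−3)/2)`. -/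
theorem stmt_7 (n : ℕ) (hn : 3 ≤ n) :
    (-2 * chowα n) * (2 * chowξ n + ((n : ChowRing n) - 3) * chowα n) ^ (n - 1) =
        2 * (((n : ChowRing n) - 3) ^ (n - 1) - ((n : ChowRing n) - 1) ^ (n - 1)) *
          chowξ n ^ n ∧
    chowα n * (2 * chowξ n + ((n : ChowRing n) - 3) * chowα n) ^ (n - 1) =
        (((n : ChowRing n) - 1) ^ (n - 1) - ((n : ChowRing n) - 3) ^ (n - 1)) *
          chowξ n ^ n := by
  have key := mul_two_mul_add_mul_pow_of_sq_eq_mul (chowξ_sq n) ((n : ChowRing n) - 3) (n - 1)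
  rw [Nat.sub_add_cancel (by omega : 1 ≤ n), chowα_pow,
    show (n : ChowRing n) - 3 + 2 = n - 1 by ring, mul_zero, zero_add] at key
  exact ⟨by linear_combination -2 * key, key⟩
end
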